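/- arXiv:2401.01396 — 2 statements merged into one kernel-verified Lean document; each statement's English description precedes it below -/
import Mathlib

section
/- Let ν ∈ (0,1), let q > 0, and let κ : ℝ → ℝ satisfy κ(0) = 0 and κ(u)/u² → q/2 as u → 0 with u ≠ 0. Let a : (0,∞) → (0,∞) satisfy a(t) → 0 and t·a(t) → ∞ as t → ∞. Then for every real θ, lim_{t→∞} a(t) · log E_ν( κ( θ · (a(t)·t)^{−ν/2} ) · t^ν ) = (q θ²/2)^{1/ν}. -/
open Filter

noncomputable def mittagLeffler (ν x : ℝ) : ℝ := ∑' k : ℕ, x ^ k / Real.Gamma (ν * k + 1)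

theorem rpow_le_exp_mul_Gamma_add_one {s z : ℝ} (hs : 0 ≤ s) (hz : 0 ≤ z) :
    z ^ s ≤ Real.exp z * Real.Gamma (s + 1) := by
  have hint := Real.GammaIntegral_convergent (show 0 < s + 1 by linarith)
  have hsub : Set.Ioi z ⊆ Set.Ioi 0 := Set.Ioi_subset_Ioi hz
  have key : z ^ s * Real.exp (-z) ≤ Real.Gamma (s + 1) := by
    calc z ^ s * Real.exp (-z) = ∫ x in Set.Ioi z, Real.exp (-x) * z ^ s := by
          rw [MeasureTheory.integral_mul_const, integral_exp_neg_Ioi, mul_comm]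
      _ ≤ ∫ x in Set.Ioi z, Real.exp (-x) * x ^ (s + 1 - 1) := by
          refine MeasureTheory.setIntegral_mono_on ((integrableOn_exp_neg_Ioi z).mul_const _)
            (hint.mono_set hsub) measurableSet_Ioi fun x hx => ?_
          have hx' : z ≤ x := le_of_lt hx
          rw [add_sub_cancel_right]
          gcongr
      _ ≤ ∫ x in Set.Ioi 0, Real.exp (-x) * x ^ (s + 1 - 1) := by
          refine MeasureTheory.setIntegral_mono_set hint ?_ hsub.eventuallyLE
          filter_upwards [MeasureTheory.self_mem_ae_restrict measurableSet_Ioi] with x hx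
          exact mul_nonneg (Real.exp_pos _).le (Real.rpow_nonneg (le_of_lt hx) _)
      _ = Real.Gamma (s + 1) := (Real.Gamma_eq_integral (by linarith)).symm
  rw [Real.exp_neg, ← div_eq_mul_inv, div_le_iff₀ (Real.exp_pos _)] at key
  linarith

theorem mittagLeffler_term_le {ν r y : ℝ} (hν : 0 < ν) (hr : 0 < r) (hy : 0 ≤ y) (k : ℕ) :
    (y ^ ν) ^ k / Real.Gamma (ν * k + 1) ≤ Real.exp (r * y) * ((r ^ ν)⁻¹) ^ k := by
  have hs : 0 ≤ ν * k := by positivity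
  have hG : 0 < Real.Gamma (ν * k + 1) := Real.Gamma_pos_of_pos (by linarith)
  have h := rpow_le_exp_mul_Gamma_add_one hs (mul_nonneg hr.le hy)
  rw [Real.mul_rpow hr.le hy, Real.rpow_mul hr.le, Real.rpow_mul hy, Real.rpow_natCast,
    Real.rpow_natCast] at h
  have hrk : 0 < (r ^ ν) ^ k := by positivity
  rw [inv_pow, ← div_eq_mul_inv, div_le_div_iff₀ hG hrk]
  linarith

theorem mittagLeffler_term_nonneg {ν x : ℝ} (hν : 0 < ν) (hx : 0 ≤ x) (k : ℕ) :
    0 ≤ x ^ k / Real.Gamma (ν * k + 1) :=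
  div_nonneg (pow_nonneg hx k) (Real.Gamma_pos_of_pos (by positivity)).le

theorem summable_inv_rpow_pow {ν r : ℝ} (hν : 0 < ν) (hr : 1 < r) :
    Summable fun k : ℕ => ((r ^ ν)⁻¹) ^ k :=
  summable_geometric_of_lt_one (by positivity) (inv_lt_one_of_one_lt₀ (Real.one_lt_rpow hr hν))

theorem summable_mittagLeffler {ν y : ℝ} (hν : 0 < ν) (hy : 0 ≤ y) :
    Summable fun k : ℕ => (y ^ ν) ^ k / Real.Gamma (ν * k + 1) :=
  .of_nonneg_of_le (mittagLeffler_term_nonneg hν (Real.rpow_nonneg hy ν))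
    (mittagLeffler_term_le hν two_pos hy)
    ((summable_inv_rpow_pow hν one_lt_two).mul_left _)

theorem mittagLeffler_rpow_le {ν r y : ℝ} (hν : 0 < ν) (hr : 1 < r) (hy : 0 ≤ y) :
    mittagLeffler ν (y ^ ν) ≤ Real.exp (r * y) * ∑' k : ℕ, ((r ^ ν)⁻¹) ^ k := by
  rw [← tsum_mul_left]
  exact (summable_mittagLeffler hν hy).tsum_le_tsum
    (mittagLeffler_term_le hν (one_pos.trans hr) hy)
    ((summable_inv_rpow_pow hν hr).mul_left _)

theorem one_le_mittagLeffler_rpow {ν y : ℝ} (hν : 0 < ν) (hy : 0 ≤ y) :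
    1 ≤ mittagLeffler ν (y ^ ν) := by
  simpa [mittagLeffler] using (summable_mittagLeffler hν hy).le_tsum 0
    fun k _ => mittagLeffler_term_nonneg hν (Real.rpow_nonneg hy ν) k

theorem pow_div_factorial_le_mittagLeffler_term {ν y : ℝ} (hν0 : 0 < ν) (hν1 : ν < 1)
    (hy : 1 ≤ y) (n : ℕ) :
    y ^ n / (n + 1).factorial ≤
      (y ^ ν) ^ ⌈n / ν⌉₊ / Real.Gamma (ν * ⌈n / ν⌉₊ + 1) := by
  have hy0 : 0 ≤ y := zero_le_one.trans hy
  have hlo : (n : ℝ) ≤ ν * ⌈n / ν⌉₊ := by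
    have := Nat.le_ceil (n / ν)
    rwa [div_le_iff₀' hν0] at this
  have hhi : ν * ⌈n / ν⌉₊ ≤ n + 1 := by
    have h := Nat.ceil_lt_add_one (show 0 ≤ n / ν by positivity)
    calc ν * ⌈n / ν⌉₊ ≤ ν * (n / ν + 1) := by gcongr
      _ = n + ν := by field_simp
      _ ≤ n + 1 := by linarith
  have hG : Real.Gamma (ν * ⌈n / ν⌉₊ + 1) ≤ (n + 1).factorial := by
    rcases n.eq_zero_or_pos with rfl | hn
    · simp
    · have hn' : (1 : ℝ) ≤ n := by exact_mod_cast hn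
      rw [← Real.Gamma_nat_eq_factorial]
      refine Real.Gamma_strictMonoOn_Ici.monotoneOn ?_ ?_ ?_
      · rw [Set.mem_Ici]; linarith
      · rw [Set.mem_Ici]; push_cast; linarith
      · push_cast; linarith
  have hGpos : 0 < Real.Gamma (ν * ⌈n / ν⌉₊ + 1) := Real.Gamma_pos_of_pos (by positivity)
  have hpow : y ^ n ≤ (y ^ ν) ^ ⌈n / ν⌉₊ := by
    rw [← Real.rpow_natCast, ← Real.rpow_natCast, ← Real.rpow_mul hy0]
    exact Real.rpow_le_rpow_of_exponent_le hy hlo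
  gcongr

theorem injective_ceil_div {ν : ℝ} (hν0 : 0 < ν) (hν1 : ν < 1) :
    Function.Injective fun n : ℕ => ⌈n / ν⌉₊ := by
  refine (strictMono_nat_of_lt_succ fun n => ?_).injective
  have h1 : (n : ℝ) / ν + 1 < (n + 1 : ℕ) / ν := by
    have : 1 < 1 / ν := by rwa [lt_div_iff₀ hν0, one_mul]
    push_cast
    rw [add_div]
    linarith
  have h2 := Nat.ceil_lt_add_one (show 0 ≤ n / ν by positivity)
  exact_mod_cast (h2.trans h1).trans_le (Nat.le_ceil _)

theorem exp_sub_one_div_le_mittagLeffler {ν y : ℝ} (hν0 : 0 < ν) (hν1 : ν < 1) (hy : 1 ≤ y) :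
    (Real.exp y - 1) / y ≤ mittagLeffler ν (y ^ ν) := by
  have hy0 : 0 < y := one_pos.trans_le hy
  have hexp : HasSum (fun n : ℕ => y ^ n / n.factorial) (Real.exp y) := by
    rw [Real.exp_eq_exp_ℝ]
    exact NormedSpace.expSeries_div_hasSum_exp y
  have hsum : HasSum (fun n : ℕ => y ^ n / (n + 1).factorial) ((Real.exp y - 1) / y) := by
    have h := ((hasSum_nat_add_iff' 1).2 hexp).div_const y
    simp only [Finset.sum_range_one, pow_zero, Nat.factorial_zero, Nat.cast_one, div_one] at h
    refine h.congr_fun ?_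
    intro n
    rw [pow_succ]
    field_simp
  exact hasSum_le_inj _ (injective_ceil_div hν0 hν1)
    (fun k _ => mittagLeffler_term_nonneg hν0 (Real.rpow_nonneg hy0.le ν) k)
    (pow_div_factorial_le_mittagLeffler_term hν0 hν1 hy) hsum
    (summable_mittagLeffler hν0 hy0.le).hasSum

theorem tendsto_log_mittagLeffler_rpow_div {ν : ℝ} (hν0 : 0 < ν) (hν1 : ν < 1) :
    Tendsto (fun y => Real.log (mittagLeffler ν (y ^ ν)) / y) atTop (nhds 1) := by
  refine tendsto_order.2 ⟨fun b hb => ?_, fun b hb => ?_⟩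
  · have hlog : Tendsto (fun y : ℝ => Real.log y / y) atTop (nhds 0) :=
      Real.isLittleO_log_id_atTop.tendsto_div_nhds_zero
    have hlim : Tendsto (fun y : ℝ => 1 - Real.log 2 / y - Real.log y / y) atTop
        (nhds (1 - 0 - 0)) :=
      (tendsto_const_nhds.sub (tendsto_const_nhds.div_atTop tendsto_id)).sub hlog
    filter_upwards [hlim.eventually (lt_mem_nhds (by simpa using hb)), eventually_ge_atTop 1]
      with y hby hy
    have hy0 : 0 < y := one_pos.trans_le hy
    have h2 : Real.exp y / 2 / y ≤ mittagLeffler ν (y ^ ν) := by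
      refine le_trans ?_ (exp_sub_one_div_le_mittagLeffler hν0 hν1 hy)
      have := Real.add_one_le_exp y
      gcongr
      linarith
    have h3 := Real.log_le_log (by positivity) h2
    rw [Real.log_div (by positivity) hy0.ne', Real.log_div (by positivity) two_ne_zero,
      Real.log_exp] at h3
    refine hby.trans_le ?_
    calc 1 - Real.log 2 / y - Real.log y / y = (y - Real.log 2 - Real.log y) / y := by
          field_simp
      _ ≤ _ := by gcongr
  · obtain ⟨r, hr1, hrb⟩ := exists_between hb
    set C := ∑' k : ℕ, ((r ^ ν)⁻¹) ^ k
    have hlim : Tendsto (fun y : ℝ => r + Real.log C / y) atTop (nhds (r + 0)) :=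
      tendsto_const_nhds.add (tendsto_const_nhds.div_atTop tendsto_id)
    filter_upwards [hlim.eventually (gt_mem_nhds (by simpa using hrb)), eventually_gt_atTop 0]
      with y hby hy0
    refine lt_of_le_of_lt ?_ hby
    have hE := one_le_mittagLeffler_rpow hν0 hy0.le
    have hle : _ ≤ _ * C := mittagLeffler_rpow_le hν0 hr1 hy0.le
    have hC : 0 < C := pos_of_mul_pos_right (by linarith) (Real.exp_pos (r * y)).le
    have h3 := Real.log_le_log (by linarith) hle
    rw [Real.log_mul (Real.exp_pos _).ne' hC.ne', Real.log_exp] at h3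
    calc _ ≤ (r * y + Real.log C) / y := by gcongr
      _ = _ := by field_simp

theorem tendsto_mul_log_mittagLeffler {ι : Type*} {l : Filter ι} {ν c : ℝ} (hν0 : 0 < ν)
    (hν1 : ν < 1) (hc : 0 < c) {a x : ι → ℝ} (ha_pos : ∀ᶠ t in l, 0 < a t)
    (ha0 : Tendsto a l (nhds 0)) (hx : Tendsto (fun t => a t ^ ν * x t) l (nhds c)) :
    Tendsto (fun t => a t * Real.log (mittagLeffler ν (x t))) l (nhds (c ^ (1 / ν))) := by
  have hay : Tendsto (fun t => (a t ^ ν * x t) ^ (1 / ν)) l (nhds (c ^ (1 / ν))) :=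
    hx.rpow_const (Or.inl hc.ne')
  have hpos : ∀ᶠ t in l, 0 < a t ∧ 0 < x t := by
    filter_upwards [ha_pos, hx.eventually (lt_mem_nhds hc)] with t hat ht
    exact ⟨hat, pos_of_mul_pos_right ht (by positivity)⟩
  have heq : ∀ᶠ t in l, (a t ^ ν * x t) ^ (1 / ν) = a t * x t ^ (1 / ν) := by
    filter_upwards [hpos] with t ⟨hat, hxt⟩
    rw [Real.mul_rpow (by positivity) hxt.le, ← Real.rpow_mul hat.le, mul_one_div_cancel hν0.ne',
      Real.rpow_one]
  have ha_inv : Tendsto (fun t => (a t)⁻¹) l atTop :=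
    (tendsto_nhdsWithin_iff.2 ⟨ha0, ha_pos⟩).inv_tendsto_nhdsGT_zero
  have hy : Tendsto (fun t => x t ^ (1 / ν)) l atTop := by
    refine (hay.pos_mul_atTop (by positivity) ha_inv).congr' ?_
    filter_upwards [hpos, heq] with t ⟨hat, _⟩ ht
    rw [ht]
    field_simp
  have hmain := hay.mul ((tendsto_log_mittagLeffler_rpow_div hν0 hν1).comp hy)
  rw [mul_one] at hmain
  refine hmain.congr' ?_
  filter_upwards [hpos, heq] with t ⟨_, hxt⟩ ht
  have hyt : 0 < x t ^ (1 / ν) := by positivity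
  have hxy : (x t ^ (1 / ν)) ^ ν = x t := by
    rw [← Real.rpow_mul hxt.le, one_div_mul_cancel hν0.ne', Real.rpow_one]
  rw [ht, Function.comp_apply, hxy]
  field_simp

open Filter


theorem mittagLeffler_MD_limit_centered (ν : ℝ) (hν : ν ∈ Set.Ioo (0 : ℝ) 1)
    (q : ℝ) (hq : 0 < q) (κ : ℝ → ℝ) (hκ0 : κ 0 = 0)
    (hκ : Tendsto (fun u : ℝ => κ u / u ^ 2) (nhdsWithin 0 {(0 : ℝ)}ᶜ) (nhds (q / 2)))
    (a : ℝ → ℝ) (ha_pos : ∀ t : ℝ, 0 < t → 0 < a t)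
    (ha0 : Tendsto a atTop (nhds 0))
    (hat : Tendsto (fun t : ℝ => t * a t) atTop atTop)
    (θ : ℝ) :
    Tendsto (fun t : ℝ =>
        a t * Real.log (mittagLeffler ν (κ (θ * (a t * t) ^ (-(ν / 2))) * t ^ ν)))
      atTop (nhds ((q * θ ^ 2 / 2) ^ (1 / ν))) := by
  obtain ⟨hν0, hν1⟩ := hν
  rcases eq_or_ne θ 0 with rfl | hθ
  · have h1 : mittagLeffler ν 0 = 1 := by
      rw [mittagLeffler, tsum_eq_single 0 fun k hk => by simp [hk]]
      simp
    simp [hκ0, h1, hν0.ne']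
  have hat' : Tendsto (fun t => a t * t) atTop atTop := by simpa only [mul_comm] using hat
  refine tendsto_mul_log_mittagLeffler hν0 hν1 (by positivity)
    ((eventually_gt_atTop 0).mono ha_pos) ha0 ?_
  have hu : Tendsto (fun t => θ * (a t * t) ^ (-(ν / 2))) atTop
      (nhdsWithin 0 {(0 : ℝ)}ᶜ) := by
    refine tendsto_nhdsWithin_iff.2 ⟨?_, ?_⟩
    · simpa using ((tendsto_rpow_neg_atTop (half_pos hν0)).comp hat').const_mul θ
    · filter_upwards [hat'.eventually_gt_atTop 0] with t ht
      exact mul_ne_zero hθ (Real.rpow_pos_of_pos ht _).ne'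
  have hlim := (hκ.comp hu).mul_const (θ ^ 2)
  rw [show q * θ ^ 2 / 2 = q / 2 * θ ^ 2 by ring]
  refine hlim.congr' ?_
  filter_upwards [eventually_gt_atTop 0] with t ht
  have hat0 := ha_pos t ht
  have hprod : 0 < a t * t := mul_pos hat0 ht
  have hsq : ((a t * t) ^ (-(ν / 2))) ^ 2 * (a t ^ ν * t ^ ν) = 1 := by
    rw [← Real.mul_rpow hat0.le ht.le, ← Real.rpow_natCast, ← Real.rpow_mul hprod.le,
      ← Real.rpow_add hprod]
    norm_num
  have hb : (a t * t) ^ (-(ν / 2)) ≠ 0 := (Real.rpow_pos_of_pos hprod _).ne'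
  rw [Function.comp_apply]
  generalize κ (θ * (a t * t) ^ (-(ν / 2))) = K
  rw [mul_pow, div_mul_eq_mul_div, div_eq_iff (by positivity)]
  linear_combination (-K * θ ^ 2) * hsq
end

section
/- Fix β ∈ (0,1), r₁, r₂ > 0 and ν ∈ (0,1). With the rate functions I_ν, J_ν of the tempered stable example, one has I_ν(0) = J_ν(0) = 0 and, for every real x ≠ 0, I_ν(x) > J_ν(x) > 0. -/
/-- Lévy exponent of a tempered stable subordinator with parameters `β` and `r`
(for arguments `θ ≤ r`). -/
noncomputable def kappaTS (β r θ : ℝ) : ℝ := r ^ β - (r - θ) ^ β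

/-- The function `Ψ_ν` of the tempered stable example (for `θ ∈ [-r₂, r₁]`). -/
noncomputable def PsiTS (β r₁ r₂ ν θ : ℝ) : ℝ :=
  if 0 ≤ θ then (kappaTS β r₁ θ) ^ (1 / ν) else (kappaTS β r₂ (-θ)) ^ (1 / ν)

/-- The function `Λ_ν` of the tempered stable example (for `θ ∈ [-r₂, r₁]`). -/
noncomputable def LamTS (β r₁ r₂ ν θ : ℝ) : ℝ :=
  (max (kappaTS β r₁ θ + kappaTS β r₂ (-θ)) 0) ^ (1 / ν)

/-- Rate function `J_ν` of the tempered stable example. -/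
noncomputable def JrateTS (β r₁ r₂ ν x : ℝ) : ℝ :=
  ⨆ θ : Set.Icc (-r₂) r₁, ((θ : ℝ) * x - PsiTS β r₁ r₂ ν θ)

/-- Rate function `I_ν` of the tempered stable example. -/
noncomputable def IrateTS (β r₁ r₂ ν x : ℝ) : ℝ :=
  ⨆ θ : Set.Icc (-r₂) r₁, ((θ : ℝ) * x - LamTS β r₁ r₂ ν θ)

theorem continuous_kappaTS {β : ℝ} (hβ : 0 ≤ β) (r : ℝ) : Continuous (kappaTS β r) :=
  continuous_const.sub ((Real.continuous_rpow_const hβ).comp (continuous_const.sub continuous_id))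

theorem kappaTS_zero (β r : ℝ) : kappaTS β r 0 = 0 := by simp [kappaTS]

theorem kappaTS_pos {β r θ : ℝ} (hβ : 0 < β) (hθ : 0 < θ) (hθr : θ ≤ r) :
    0 < kappaTS β r θ :=
  sub_pos.2 (Real.rpow_lt_rpow (by linarith) (by linarith) hβ)

theorem kappaTS_neg {β r θ : ℝ} (hβ : 0 < β) (hr : 0 ≤ r) (hθ : θ < 0) :
    kappaTS β r θ < 0 :=
  sub_neg.2 (Real.rpow_lt_rpow hr (by linarith) hβ)

theorem kappaTS_mul_le {β r s : ℝ} (hβ : β ≤ 1) (hr : 0 ≤ r) (hs : 0 < s)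
    (hs1 : s < 1) : kappaTS β r (r * s) ≤ r ^ β * s := by
  have h : 1 - s ≤ (1 - s) ^ β :=
    Real.self_le_rpow_of_le_one (by linarith) (by linarith) hβ
  have h2 : (r - r * s) ^ β = r ^ β * (1 - s) ^ β := by
    rw [← Real.mul_rpow hr (by linarith), mul_sub, mul_one]
  have h3 := mul_le_mul_of_nonneg_left h (Real.rpow_nonneg hr β)
  unfold kappaTS
  rw [h2]
  linarith

theorem exists_mul_rpow_lt_mul {p d : ℝ} (hp : 1 < p) (C : ℝ) (hd : 0 < d) :
    ∃ s ∈ Set.Ioo (0 : ℝ) 1, C * s ^ p < d * s := by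
  have hc : Continuous fun s : ℝ => C * s ^ (p - 1) :=
    continuous_const.mul (Real.continuous_rpow_const (by linarith))
  have h0 : C * (0 : ℝ) ^ (p - 1) < d := by
    rw [Real.zero_rpow (by linarith), mul_zero]
    exact hd
  have hev : ∀ᶠ s in nhdsWithin (0 : ℝ) (Set.Ioi 0), C * s ^ (p - 1) < d :=
    (hc.continuousAt.eventually_lt continuousAt_const h0).filter_mono nhdsWithin_le_nhds
  obtain ⟨s, hs, hs01⟩ := (hev.and (Ioo_mem_nhdsGT zero_lt_one)).exists
  refine ⟨s, hs01, ?_⟩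
  have h := mul_lt_mul_of_pos_right hs hs01.1
  rwa [mul_assoc, ← Real.rpow_add_one hs01.1.ne', sub_add_cancel] at h

theorem exists_kappaTS_rpow_lt_mul {β r p y : ℝ} (hβ : β ∈ Set.Ioo (0 : ℝ) 1) (hr : 0 < r)
    (hp : 1 < p) (hy : 0 < y) : ∃ θ ∈ Set.Ioc 0 r, kappaTS β r θ ^ p < θ * y := by
  obtain ⟨s, hs, hlt⟩ := exists_mul_rpow_lt_mul hp ((r ^ β) ^ p) (mul_pos hr hy)
  have hle : r * s ≤ r := mul_le_of_le_one_right hr.le hs.2.le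
  refine ⟨r * s, ⟨mul_pos hr hs.1, hle⟩, ?_⟩
  calc kappaTS β r (r * s) ^ p
      ≤ (r ^ β * s) ^ p :=
        Real.rpow_le_rpow (kappaTS_pos hβ.1 (mul_pos hr hs.1) hle).le
          (kappaTS_mul_le hβ.2.le hr.le hs.1 hs.2) (by linarith)
    _ = (r ^ β) ^ p * s ^ p := Real.mul_rpow (Real.rpow_nonneg hr.le β) hs.1.le
    _ < r * y * s := hlt
    _ = r * s * y := by ring

theorem PsiTS_zero {β r₁ r₂ ν : ℝ} (hν : 0 < ν) : PsiTS β r₁ r₂ ν 0 = 0 := by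
  simp [PsiTS, kappaTS_zero, hν.ne']

theorem LamTS_zero {β r₁ r₂ ν : ℝ} (hν : 0 < ν) : LamTS β r₁ r₂ ν 0 = 0 := by
  simp [LamTS, kappaTS_zero, hν.ne']

theorem LamTS_nonneg (β r₁ r₂ ν θ : ℝ) : 0 ≤ LamTS β r₁ r₂ ν θ :=
  Real.rpow_nonneg (le_max_right _ _) _

theorem continuous_PsiTS {β ν : ℝ} (hβ : 0 ≤ β) (hν : 0 < ν) (r₁ r₂ : ℝ) :
    Continuous (PsiTS β r₁ r₂ ν) := by
  have hp : 0 ≤ 1 / ν := by positivity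
  refine Continuous.if_le
    ((Real.continuous_rpow_const hp).comp (continuous_kappaTS hβ r₁))
    ((Real.continuous_rpow_const hp).comp ((continuous_kappaTS hβ r₂).comp continuous_neg))
    continuous_const continuous_id ?_
  rintro θ rfl
  simp [kappaTS_zero]

theorem continuous_LamTS {β ν : ℝ} (hβ : 0 ≤ β) (hν : 0 < ν) (r₁ r₂ : ℝ) :
    Continuous (LamTS β r₁ r₂ ν) :=
  (Real.continuous_rpow_const (by positivity)).comp
    (((continuous_kappaTS hβ r₁).add ((continuous_kappaTS hβ r₂).comp continuous_neg)).max
      continuous_const)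

theorem LamTS_lt_PsiTS {β r₁ r₂ ν θ : ℝ} (hβ : 0 < β) (hr₁ : 0 ≤ r₁) (hr₂ : 0 ≤ r₂)
    (hν : 0 < ν) (hθ : θ ∈ Set.Icc (-r₂) r₁) (hθ0 : θ ≠ 0) :
    LamTS β r₁ r₂ ν θ < PsiTS β r₁ r₂ ν θ := by
  have hp : 0 < 1 / ν := by positivity
  unfold LamTS PsiTS
  rcases lt_or_gt_of_ne hθ0 with h | h
  · rw [if_neg (not_le.2 h)]
    have h1 := kappaTS_neg hβ hr₁ h
    have h2 := kappaTS_pos hβ (neg_pos.2 h) (neg_le.1 hθ.1)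
    exact Real.rpow_lt_rpow (le_max_right _ _) (max_lt (by linarith) h2) hp
  · rw [if_pos h.le]
    have h1 := kappaTS_pos hβ h hθ.2
    have h2 := kappaTS_neg hβ hr₂ (neg_neg_of_pos h)
    exact Real.rpow_lt_rpow (le_max_right _ _) (max_lt (by linarith) h1) hp

theorem exists_PsiTS_lt_mul {β r₁ r₂ ν x : ℝ} (hβ : β ∈ Set.Ioo (0 : ℝ) 1) (hr₁ : 0 < r₁)
    (hr₂ : 0 < r₂) (hν : ν ∈ Set.Ioo (0 : ℝ) 1) (hx : x ≠ 0) :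
    ∃ θ ∈ Set.Icc (-r₂) r₁, PsiTS β r₁ r₂ ν θ < θ * x := by
  have hp : 1 < 1 / ν := one_lt_one_div hν.1 hν.2
  rcases lt_or_gt_of_ne hx with h | h
  · obtain ⟨θ, hθ, hlt⟩ := exists_kappaTS_rpow_lt_mul hβ hr₂ hp (neg_pos.2 h)
    refine ⟨-θ, ⟨neg_le_neg hθ.2, by linarith [hθ.1]⟩, ?_⟩
    rw [PsiTS, if_neg (by linarith [hθ.1]), neg_neg]
    linarith
  · obtain ⟨θ, hθ, hlt⟩ := exists_kappaTS_rpow_lt_mul hβ hr₁ hp h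
    refine ⟨θ, ⟨by linarith [hθ.1], hθ.2⟩, ?_⟩
    rwa [PsiTS, if_pos hθ.1.le]

theorem iSup_neg_eq_zero_of_nonneg {s : Set ℝ} {F : ℝ → ℝ} (h0 : (0 : ℝ) ∈ s) (hF0 : F 0 = 0)
    (hF : ∀ θ ∈ s, 0 ≤ F θ) : ⨆ θ : s, ((θ : ℝ) * 0 - F θ) = 0 := by
  have hle : ∀ θ : s, (θ : ℝ) * 0 - F θ ≤ 0 := fun θ => by
    have := hF θ θ.2
    linarith
  have : Nonempty s := ⟨⟨0, h0⟩⟩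
  refine le_antisymm (ciSup_le hle) ?_
  have h := le_ciSup (f := fun θ : s => (θ : ℝ) * 0 - F θ)
    ⟨0, Set.forall_mem_range.2 hle⟩ ⟨0, h0⟩
  simpa [hF0] using h

theorem rate_function_comparison_TS
    (β r₁ r₂ ν : ℝ) (hβ : β ∈ Set.Ioo (0 : ℝ) 1) (hr₁ : 0 < r₁) (hr₂ : 0 < r₂)
    (hν : ν ∈ Set.Ioo (0 : ℝ) 1) :
    IrateTS β r₁ r₂ ν 0 = 0 ∧ JrateTS β r₁ r₂ ν 0 = 0 ∧
    ∀ x : ℝ, x ≠ 0 → IrateTS β r₁ r₂ ν x > JrateTS β r₁ r₂ ν x ∧ JrateTS β r₁ r₂ ν x > 0 := by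
  have h0 : (0 : ℝ) ∈ Set.Icc (-r₂) r₁ := ⟨by linarith, hr₁.le⟩
  have hΨ : ∀ θ ∈ Set.Icc (-r₂) r₁, 0 ≤ PsiTS β r₁ r₂ ν θ := by
    intro θ hθ
    rcases eq_or_ne θ 0 with rfl | hne
    · rw [PsiTS_zero hν.1]
    · exact (LamTS_nonneg _ _ _ _ _).trans
        (LamTS_lt_PsiTS hβ.1 hr₁.le hr₂.le hν.1 hθ hne).le
  refine ⟨iSup_neg_eq_zero_of_nonneg h0 (LamTS_zero hν.1) fun θ _ => LamTS_nonneg _ _ _ _ θ,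
    iSup_neg_eq_zero_of_nonneg h0 (PsiTS_zero hν.1) hΨ, fun x hx => ?_⟩
  have : Nonempty (Set.Icc (-r₂) r₁) := ⟨⟨0, h0⟩⟩
  have hcJ : Continuous fun θ : Set.Icc (-r₂) r₁ => (θ : ℝ) * x - PsiTS β r₁ r₂ ν θ :=
    (continuous_subtype_val.mul continuous_const).sub
      ((continuous_PsiTS hβ.1.le hν.1 r₁ r₂).comp continuous_subtype_val)
  have hcI : Continuous fun θ : Set.Icc (-r₂) r₁ => (θ : ℝ) * x - LamTS β r₁ r₂ ν θ :=
    (continuous_subtype_val.mul continuous_const).sub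
      ((continuous_LamTS hβ.1.le hν.1 r₁ r₂).comp continuous_subtype_val)
  have hJpos : 0 < JrateTS β r₁ r₂ ν x := by
    obtain ⟨θ, hθ, hlt⟩ := exists_PsiTS_lt_mul hβ hr₁ hr₂ hν hx
    exact (sub_pos.2 hlt).trans_le (le_ciSup (isCompact_range hcJ).bddAbove ⟨θ, hθ⟩)
  obtain ⟨θ, hmax⟩ : JrateTS β r₁ r₂ ν x ∈
      Set.range fun θ : Set.Icc (-r₂) r₁ => (θ : ℝ) * x - PsiTS β r₁ r₂ ν θ :=
    (isCompact_range hcJ).sSup_mem (Set.range_nonempty _)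
  have hmax : (θ : ℝ) * x - PsiTS β r₁ r₂ ν θ = JrateTS β r₁ r₂ ν x := hmax
  have hne : (θ : ℝ) ≠ 0 := by
    intro h
    rw [h, PsiTS_zero hν.1] at hmax
    linarith
  have hle : (θ : ℝ) * x - LamTS β r₁ r₂ ν θ ≤ IrateTS β r₁ r₂ ν x :=
    le_ciSup (isCompact_range hcI).bddAbove θ
  have hlt := LamTS_lt_PsiTS hβ.1 hr₁.le hr₂.le hν.1 θ.2 hne
  exact ⟨by linarith, hJpos⟩
end
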